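/- Let G be a finite graph of maximum degree at most Δ whose vertex set is partitioned into blocks V = V_1 ⊔ … ⊔ V_k, each block of size exactly b. If b ≥ (256/27)·Δ, then G has a strong coloring: a proper vertex coloring χ : V → [b] whose restriction to each block V_i is a bijection onto [b]. -/

import Mathlib

open Classical in
/-- The independent partial transversals of the blocks indexed by `S`, with vertices taken from `A`.
They are encoded as functions taking the default value `v₀` outside `S`. -/
noncomputable def indepTransversals {ι V : Type*} [Fintype ι] [Fintype V] (H : SimpleGraph V)
    (part : V → ι) (A : Finset V) (v₀ : V) (S : Finset ι) : Finset (ι → V) :=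
  Finset.univ.filter fun f =>
    (∀ i ∈ S, f i ∈ A ∧ part (f i) = i) ∧ (∀ i ∉ S, f i = v₀) ∧
      ∀ i ∈ S, ∀ j ∈ S, ¬ H.Adj (f i) (f j)

section IndepTransversals

variable {ι V : Type*} [Fintype ι] [Fintype V] {H : SimpleGraph V} {part : V → ι}
  {A : Finset V} {v₀ : V} {S : Finset ι}

lemma mem_indepTransversals {f : ι → V} :
    f ∈ indepTransversals H part A v₀ S ↔
      (∀ i ∈ S, f i ∈ A ∧ part (f i) = i) ∧ (∀ i ∉ S, f i = v₀) ∧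
        ∀ i ∈ S, ∀ j ∈ S, ¬ H.Adj (f i) (f j) := by
  simp [indepTransversals]

open Classical in
lemma card_indepTransversals_through_le {j : ι} (hj : j ∈ S) (u : V) :
    ((indepTransversals H part A v₀ S).filter fun f => f j = u).card ≤
      (indepTransversals H part A v₀ (S.erase j)).card := by
  refine Finset.card_le_card_of_injOn (fun f => Function.update f j v₀) ?_ ?_
  · intro f hf
    simp only [Finset.coe_filter, Set.mem_ofPred_eq, mem_indepTransversals] at hf
    obtain ⟨⟨h1, h2, h3⟩, -⟩ := hf
    simp only [Finset.mem_coe, mem_indepTransversals]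
    refine ⟨fun i hi => ?_, fun i hi => ?_, fun i hi l hl => ?_⟩
    · rw [Finset.mem_erase] at hi
      rw [Function.update_of_ne hi.1]
      exact h1 i hi.2
    · by_cases hij : i = j
      · subst hij; simp
      · rw [Function.update_of_ne hij]
        exact h2 i fun h => hi (Finset.mem_erase.2 ⟨hij, h⟩)
    · rw [Finset.mem_erase] at hi hl
      rw [Function.update_of_ne hi.1, Function.update_of_ne hl.1]
      exact h3 i hi.2 l hl.2
  · intro f hf g hg hfg
    simp only [Finset.coe_filter, Set.mem_ofPred_eq] at hf hg
    funext i
    by_cases hij : i = j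
    · subst hij; rw [hf.2, hg.2]
    · simpa [Function.update_of_ne hij] using congrFun hfg i

open Classical in
lemma card_extensions_le {i : ι} (hi : i ∉ S) :
    (((A.filter fun v => part v = i) ×ˢ indepTransversals H part A v₀ S).filter
        fun p => ∀ j ∈ S, ¬ H.Adj p.1 (p.2 j)).card ≤
      (indepTransversals H part A v₀ (insert i S)).card := by
  refine Finset.card_le_card_of_injOn (fun p => Function.update p.2 i p.1) ?_ ?_
  · rintro ⟨v, f⟩ hf
    simp only [Finset.coe_filter, Set.mem_ofPred_eq, Finset.mem_product, Finset.mem_filter,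
      mem_indepTransversals] at hf
    obtain ⟨⟨⟨hvA, hvi⟩, h1, h2, h3⟩, h4⟩ := hf
    have hne : ∀ j ∈ S, j ≠ i := fun j hj h => hi (h ▸ hj)
    simp only [Finset.mem_coe, mem_indepTransversals]
    refine ⟨fun j hj => ?_, fun j hj => ?_, fun j hj l hl => ?_⟩
    · rcases Finset.mem_insert.1 hj with rfl | hj
      · simp [hvA, hvi]
      · rw [Function.update_of_ne (hne j hj)]; exact h1 j hj
    · rw [Finset.mem_insert, not_or] at hj
      rw [Function.update_of_ne hj.1]; exact h2 j hj.2
    · rcases Finset.mem_insert.1 hj with rfl | hj' <;> rcases Finset.mem_insert.1 hl with rfl | hl'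
      · simp
      · rw [Function.update_self, Function.update_of_ne (hne l hl')]; exact h4 l hl'
      · rw [Function.update_self, Function.update_of_ne (hne j hj')]
        exact fun h => h4 j hj' h.symm
      · rw [Function.update_of_ne (hne j hj'), Function.update_of_ne (hne l hl')]
        exact h3 j hj' l hl'
  · rintro ⟨v, f⟩ hf ⟨w, g⟩ hg hfg
    simp only [Finset.coe_filter, Set.mem_ofPred_eq, Finset.mem_product,
      mem_indepTransversals] at hf hg
    have hvw : v = w := by simpa using congrFun hfg i
    refine Prod.ext hvw (funext fun j => ?_)
    by_cases hij : j = i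
    · subst hij
      exact (hf.1.2.2.1 j hi).trans (hg.1.2.2.1 j hi).symm
    · simpa [Function.update_of_ne hij] using congrFun hfg j

open Classical in
/-- If every block has at least `m ≥ 4 d` available vertices, where `d` bounds the degrees, then
adding a block multiplies the number of independent transversals by at least `m / 2`. -/
lemma card_indepTransversals_insert {d m : ℕ}
    (hd : ∀ v, (Finset.univ.filter (H.Adj v)).card ≤ d) (hm : 4 * d ≤ m)
    (hA : ∀ i, m ≤ (A.filter fun v => part v = i).card) (v₀ : V) (S : Finset ι) :
    ∀ i ∉ S, m * (indepTransversals H part A v₀ S).card ≤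
      2 * (indepTransversals H part A v₀ (insert i S)).card := by
  induction S using Finset.strongInduction with
  | H S ih =>
  intro i hi
  rcases Nat.eq_zero_or_pos m with rfl | hmpos
  · simp
  set I := indepTransversals H part A v₀ S with hI
  set B := A.filter fun v => part v = i with hB
  have through : ∀ u, m * (I.filter fun f => ∃ j ∈ S, f j = u).card ≤ 2 * I.card := by
    intro u
    by_cases hu : part u ∈ S
    · have h1 : (I.filter fun f => ∃ j ∈ S, f j = u) ⊆ I.filter fun f => f (part u) = u := by
        intro f hf
        rw [Finset.mem_filter] at hf ⊢
        obtain ⟨hf, j, hj, rfl⟩ := hf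
        refine ⟨hf, ?_⟩
        rw [((mem_indepTransversals.1 hf).1 j hj).2]
      have h2 := ih _ (Finset.erase_ssubset hu) (part u) (Finset.notMem_erase _ _)
      rw [Finset.insert_erase hu] at h2
      exact (Nat.mul_le_mul_left m ((Finset.card_le_card h1).trans
        (card_indepTransversals_through_le hu u))).trans h2
    · have h1 : (I.filter fun f => ∃ j ∈ S, f j = u) = ∅ := by
        refine Finset.filter_eq_empty_iff.2 ?_
        rintro f hf ⟨j, hj, rfl⟩
        exact hu (by rwa [((mem_indepTransversals.1 hf).1 j hj).2])
      simp [h1]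
  have bad : ∀ v, m * (I.filter fun f => ∃ j ∈ S, H.Adj v (f j)).card ≤ d * (2 * I.card) := by
    intro v
    have h1 : (I.filter fun f => ∃ j ∈ S, H.Adj v (f j)) ⊆
        (Finset.univ.filter (H.Adj v)).biUnion fun u => I.filter fun f => ∃ j ∈ S, f j = u := by
      intro f hf
      rw [Finset.mem_filter] at hf
      obtain ⟨hf, j, hj, hadj⟩ := hf
      simp only [Finset.mem_biUnion, Finset.mem_filter, Finset.mem_univ, true_and]
      exact ⟨f j, hadj, hf, j, hj, rfl⟩
    calc _ ≤ m * ∑ u ∈ Finset.univ.filter (H.Adj v), (I.filter fun f => ∃ j ∈ S, f j = u).card :=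
          Nat.mul_le_mul_left m ((Finset.card_le_card h1).trans Finset.card_biUnion_le)
      _ ≤ (Finset.univ.filter (H.Adj v)).card * (2 * I.card) := by
          rw [Finset.mul_sum]
          exact Finset.sum_le_card_nsmul _ _ _ fun u _ => through u
      _ ≤ _ := Nat.mul_le_mul_right _ (hd v)
  have badPairs : m * ((B ×ˢ I).filter fun p => ¬ ∀ j ∈ S, ¬ H.Adj p.1 (p.2 j)).card ≤
      B.card * (d * (2 * I.card)) := by
    have h1 : ((B ×ˢ I).filter fun p => ¬ ∀ j ∈ S, ¬ H.Adj p.1 (p.2 j)) ⊆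
        B.biUnion fun v => (I.filter fun f => ∃ j ∈ S, H.Adj v (f j)).image (Prod.mk v) := by
      rintro ⟨v, f⟩ hf
      simp only [Finset.mem_filter, Finset.mem_product, not_forall, not_not] at hf
      obtain ⟨⟨hv, hf⟩, j, hj, hadj⟩ := hf
      simp only [Finset.mem_biUnion, Finset.mem_image, Finset.mem_filter]
      exact ⟨v, hv, f, ⟨hf, j, hj, hadj⟩, rfl⟩
    calc _ ≤ m * ∑ v ∈ B, (I.filter fun f => ∃ j ∈ S, H.Adj v (f j)).card :=
          Nat.mul_le_mul_left m ((Finset.card_le_card h1).trans (Finset.card_biUnion_le.trans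
            (Finset.sum_le_sum fun v _ => Finset.card_image_le)))
      _ ≤ _ := by
          rw [Finset.mul_sum]
          exact Finset.sum_le_card_nsmul _ _ _ fun v _ => bad v
  have good := card_extensions_le (H := H) (part := part) (A := A) (v₀ := v₀) hi
  rw [← hI, ← hB] at good
  have split := Finset.card_filter_add_card_filter_not (s := B ×ˢ I)
    (fun p => ∀ j ∈ S, ¬ H.Adj p.1 (p.2 j))
  rw [Finset.card_product] at split
  have hBm : m ≤ B.card := hA i
  have hbad : 2 * ((B ×ˢ I).filter fun p => ¬ ∀ j ∈ S, ¬ H.Adj p.1 (p.2 j)).card ≤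
      B.card * I.card := by
    refine Nat.le_of_mul_le_mul_left ?_ hmpos
    calc _ = 2 * (m * ((B ×ˢ I).filter fun p => ¬ ∀ j ∈ S, ¬ H.Adj p.1 (p.2 j)).card) := by ring
      _ ≤ 2 * (B.card * (d * (2 * I.card))) := Nat.mul_le_mul_left 2 badPairs
      _ = 4 * d * (B.card * I.card) := by ring
      _ ≤ _ := Nat.mul_le_mul_right _ hm
  have := Nat.mul_le_mul_right I.card hBm
  omega

open Classical in
/-- Independent transversals exist when every block has at least `m ≥ 4 d` available vertices. -/
lemma exists_indepTransversal {d m : ℕ} (hd : ∀ v, (Finset.univ.filter (H.Adj v)).card ≤ d)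
    (hm : 4 * d ≤ m) (hpos : 0 < m) (hA : ∀ i, m ≤ (A.filter fun v => part v = i).card) (v₀ : V) :
    ∃ t : ι → V, (∀ i, t i ∈ A ∧ part (t i) = i) ∧ ∀ i j, ¬ H.Adj (t i) (t j) := by
  have key : ∀ S : Finset ι, 0 < (indepTransversals H part A v₀ S).card := by
    intro S
    induction S using Finset.induction_on with
    | empty =>
      exact Finset.card_pos.2 ⟨fun _ => v₀, mem_indepTransversals.2 (by simp)⟩
    | insert i S hi ih =>
      have := card_indepTransversals_insert hd hm hA v₀ S i hi
      have := Nat.mul_pos hpos ih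
      omega
  obtain ⟨t, ht⟩ := Finset.card_pos.1 (key Finset.univ)
  rw [mem_indepTransversals] at ht
  exact ⟨t, fun i => ht.1 i (Finset.mem_univ i),
    fun i j => ht.2.2 i (Finset.mem_univ i) j (Finset.mem_univ j)⟩

end IndepTransversals

open Classical in
/-- The set of monochromatic (ordered) edges of a coloring. -/
noncomputable def conflicts {V C : Type*} [Fintype V] (G : SimpleGraph V) (χ : V → C) :
    Finset (V × V) :=
  Finset.univ.filter fun p => G.Adj p.1 p.2 ∧ χ p.1 = χ p.2

lemma mem_conflicts {V C : Type*} [Fintype V] {G : SimpleGraph V} {χ : V → C} {x y : V} :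
    (x, y) ∈ conflicts G χ ↔ G.Adj x y ∧ χ x = χ y := by
  simp [conflicts]

/-- A blockwise bijective coloring with a monochromatic edge can be changed into one with fewer
monochromatic edges, by swapping one color class with an independent transversal. -/
lemma exists_conflicts_ssubset {ι V : Type*} [Fintype ι] [Fintype V] (G : SimpleGraph V) {Δ b : ℕ}
    (hdeg : ∀ v : V, (G.neighborSet v).ncard ≤ Δ) (part : V → ι) (hb : 9 * Δ ≤ b)
    (χ : V → Fin b) (hχ : ∀ i c, ∃! v : V, part v = i ∧ χ v = c)
    {p q : V} (hpq : G.Adj p q) (hcol : χ p = χ q) :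
    ∃ χ' : V → Fin b, (∀ i c, ∃! v : V, part v = i ∧ χ' v = c) ∧
      conflicts G χ' ⊂ conflicts G χ := by
  classical
  have hinj : ∀ x y, part x = part y → χ x = χ y → x = y := fun x y h1 h2 =>
    (hχ (part y) (χ y)).unique ⟨h1, h2⟩ ⟨rfl, rfl⟩
  have hparts : part p ≠ part q := fun h => hpq.ne (hinj p q h hcol)
  have hN : ∀ v, (Finset.univ.filter (G.Adj v)).card ≤ Δ := by
    intro v
    refine le_trans (le_of_eq ?_) (hdeg v)
    rw [← Set.ncard_coe_finset]
    congr 1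
    ext; simp
  have hΔ : 1 ≤ Δ :=
    le_trans (Finset.card_pos.2 ⟨q, by simpa using hpq⟩) (hN p)
  set c := χ p with hc
  let H : SimpleGraph V :=
    { Adj := fun x y => G.Adj x y ∨ (χ x = χ y ∧
        (part x = part p ∧ part y = part q ∨ part x = part q ∧ part y = part p))
      symm := ⟨fun x y h => by
        rcases h with h | ⟨h, h' | h'⟩
        · exact Or.inl h.symm
        · exact Or.inr ⟨h.symm, Or.inr h'.symm⟩
        · exact Or.inr ⟨h.symm, Or.inl h'.symm⟩⟩
      loopless := ⟨fun x h => by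
        rcases h with h | ⟨-, h | h⟩
        · exact G.loopless.irrefl x h
        · exact hparts (h.1.symm.trans h.2)
        · exact hparts (h.2.symm.trans h.1)⟩ }
  have hH : ∀ x y, H.Adj x y ↔ G.Adj x y ∨ (χ x = χ y ∧
      (part x = part p ∧ part y = part q ∨ part x = part q ∧ part y = part p)) :=
    fun _ _ => Iff.rfl
  have hd : ∀ v, (Finset.univ.filter (H.Adj v)).card ≤ Δ + 1 := by
    intro v
    obtain ⟨y, -, hy⟩ := hχ (if part v = part p then part q else part p) (χ v)
    have hsub : Finset.univ.filter (H.Adj v) ⊆ insert y (Finset.univ.filter (G.Adj v)) := by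
      intro u hu
      simp only [Finset.mem_filter, Finset.mem_univ, true_and, hH] at hu
      simp only [Finset.mem_insert, Finset.mem_filter, Finset.mem_univ, true_and]
      rcases hu with hu | ⟨h, h' | h'⟩
      · exact Or.inr hu
      · exact Or.inl (hy u ⟨by rw [if_pos h'.1, h'.2], h.symm⟩)
      · refine Or.inl (hy u ⟨?_, h.symm⟩)
        rw [if_neg (by rw [h'.1]; exact hparts.symm), h'.2]
    exact (Finset.card_le_card hsub).trans
      ((Finset.card_insert_le _ _).trans (Nat.succ_le_succ (hN v)))
  let A : Finset V := Finset.univ.filter fun v =>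
    ∀ x y, part x = part v → χ x = c → G.Adj x y → χ v ≠ χ y
  have hA : ∀ i, b - Δ ≤ (A.filter fun v => part v = i).card := by
    intro i
    obtain ⟨w, ⟨hw1, hw2⟩, hw⟩ := hχ i c
    have hsub : (Finset.univ : Finset (Fin b)) ⊆
        (A.filter fun v => part v = i).image χ ∪ (Finset.univ.filter (G.Adj w)).image χ := by
      intro a _
      obtain ⟨v, ⟨hv1, hv2⟩, -⟩ := hχ i a
      rw [Finset.mem_union, Finset.mem_image, Finset.mem_image]
      by_cases hv : v ∈ A
      · exact Or.inl ⟨v, by simp [hv, hv1], hv2⟩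
      · right
        simp only [A, Finset.mem_filter, Finset.mem_univ, true_and, not_forall, not_not] at hv
        obtain ⟨x, y, hx, hxc, hxy, hvy⟩ := hv
        have : x = w := hw x ⟨hx.trans hv1, hxc⟩
        subst this
        exact ⟨y, by simpa using hxy, hvy.symm.trans hv2⟩
    have h1 := (Finset.card_le_card hsub).trans (Finset.card_union_le _ _)
    rw [Finset.card_univ, Fintype.card_fin] at h1
    have h2 := Finset.card_image_le (s := A.filter fun v => part v = i) (f := χ)
    have h3 := Finset.card_image_le (s := Finset.univ.filter (G.Adj w)) (f := χ)
    have h4 := hN w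
    omega
  obtain ⟨t, ht, hind⟩ := exists_indepTransversal (H := H) (d := Δ + 1) (m := b - Δ)
    (fun v => by convert hd v) (by omega) (by omega) hA p
  have htA : ∀ i x y, part x = i → χ x = c → G.Adj x y → χ (t i) ≠ χ y := by
    intro i x y hx
    have := (ht i).1
    simp only [A, Finset.mem_filter, Finset.mem_univ, true_and] at this
    exact this x y (hx.trans (ht i).2.symm)
  let χ' : V → Fin b := fun x => Equiv.swap c (χ (t (part x))) (χ x)
  have hχ'c : ∀ x, χ' x = c → x = t (part x) := by
    intro x hx
    refine hinj _ _ (ht _).2.symm ?_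
    have : χ x = Equiv.swap c (χ (t (part x))) c := by
      rw [← Equiv.swap_apply_eq_iff]; exact hx
    rwa [Equiv.swap_apply_left] at this
  have hc' : ∀ x, χ x = c → χ' x = χ (t (part x)) := by
    intro x hx
    simp only [χ', hx, Equiv.swap_apply_left]
  have hne : ∀ x, χ x ≠ c → χ' x ≠ c → χ' x = χ x := by
    intro x hx hx'
    refine Equiv.swap_apply_of_ne_of_ne hx fun h => hx' ?_
    simp only [χ', h, Equiv.swap_apply_right]
  refine ⟨χ', fun i a => ?_, ?_⟩
  · obtain ⟨v, ⟨hv1, hv2⟩, hv⟩ := hχ i (Equiv.swap c (χ (t i)) a)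
    refine ⟨v, ⟨hv1, by simp [χ', hv1, hv2]⟩, ?_⟩
    rintro y ⟨rfl, hy⟩
    exact hv y ⟨rfl, by rw [← hy]; simp [χ']⟩
  · rw [Finset.ssubset_iff_of_subset]
    · refine ⟨(p, q), mem_conflicts.2 ⟨hpq, hcol⟩, fun h => ?_⟩
      have h' := (mem_conflicts.1 h).2
      rw [hc' p rfl, hc' q hcol.symm] at h'
      exact hind (part p) (part q) ((hH _ _).2 (Or.inr ⟨h', Or.inl ⟨(ht _).2, (ht _).2⟩⟩))
    · rintro ⟨x, y⟩ h
      obtain ⟨hadj, heq⟩ := mem_conflicts.1 h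
      refine mem_conflicts.2 ⟨hadj, ?_⟩
      by_cases hx : χ' x = c
      · have h1 := hχ'c x hx
        have h2 := hχ'c y (heq ▸ hx)
        refine absurd ((hH _ _).2 (Or.inl ?_)) (hind (part x) (part y))
        rwa [← h1, ← h2]
      · have hy : χ' y ≠ c := heq ▸ hx
        by_cases hxc : χ x = c <;> by_cases hyc : χ y = c
        · rw [hxc, hyc]
        · rw [hc' x hxc, hne y hyc hy] at heq
          exact absurd heq (htA _ x y rfl hxc hadj)
        · rw [hc' y hyc, hne x hxc hx] at heq
          exact absurd heq.symm (htA _ y x rfl hyc hadj.symm)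
        · rwa [hne x hxc hx, hne y hyc hy] at heq

/-- If the finite graph `G` has maximum degree at most `Δ` and its vertex set is
partitioned into `k` blocks each of size exactly `b`, with `b ≥ (256/27)·Δ`, then
`G` has a strong coloring: a proper coloring `χ : V → [b]` in which, within each
block, every color appears exactly once. -/
theorem strong_coloring_exists_256_27 (V : Type*) [Fintype V] (G : SimpleGraph V)
    (Δ b k : ℕ)
    (hdeg : ∀ v : V, (G.neighborSet v).ncard ≤ Δ)
    (part : V → Fin k) (hblock : ∀ i : Fin k, Nat.card {v : V // part v = i} = b)
    (hb : (b : ℝ) ≥ (256 / 27 : ℝ) * Δ) :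
    ∃ χ : V → Fin b, (∀ u w : V, G.Adj u w → χ u ≠ χ w) ∧
      ∀ (i : Fin k) (c : Fin b), ∃! v : V, part v = i ∧ χ v = c := by
  have hb' : 9 * Δ ≤ b := by
    have : (0 : ℝ) ≤ Δ := Nat.cast_nonneg Δ
    have : (9 * Δ : ℝ) ≤ b := by linarith
    exact_mod_cast this
  have e : ∀ i : Fin k, {v : V // part v = i} ≃ Fin b := fun i =>
    Finite.equivFinOfCardEq (hblock i)
  have hstart : ∃ χ : V → Fin b, ∀ i c, ∃! v : V, part v = i ∧ χ v = c := by
    refine ⟨fun v => e (part v) ⟨v, rfl⟩, fun i c => ⟨(e i).symm c, ⟨((e i).symm c).2, ?_⟩, ?_⟩⟩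
    · have : ∀ (j : Fin k) (x : {v : V // part v = j}), e (part x) ⟨x, rfl⟩ = e j x := by
        rintro j ⟨x, rfl⟩; rfl
      exact (this i _).trans (Equiv.apply_symm_apply _ _)
    · rintro v ⟨rfl, rfl⟩
      simp
  obtain ⟨χ, hχ, hmin⟩ := exists_minimalFor_of_wellFoundedLT
    (fun χ : V → Fin b => ∀ i c, ∃! v : V, part v = i ∧ χ v = c) (conflicts G) hstart
  refine ⟨χ, fun u w hadj hcol => ?_, hχ⟩
  obtain ⟨χ', hχ', hlt⟩ := exists_conflicts_ssubset G hdeg part hb' χ hχ hadj hcol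
  exact hlt.2 (hmin hχ' hlt.1)
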